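/- arXiv:2306.01154 — 2 statements merged into one kernel-verified Lean document; each statement's English description precedes it below -/
import Mathlib

section
/- Let W₁,…,W_L be matrices whose product W_{L:1} has σ_K(W_{L:1}) = σ₁(W_{L:1}) = √n for its top K singular values (rank K), with W_{l+1}ᵀW_{l+1} = W_l W_lᵀ for all l ∈ [L−2] and ‖W_LᵀW_L − W_{L−1}W_{L−1}ᵀ‖_F ≤ δ where δ ≤ n^{1/L}/(30L²), and suppose σ₁(W_l) ≤ (2n)^{1/(2L)} for all l. Then σ_K(W_l) ≥ (n/2)^{1/(2L)} for all l ∈ [L]. -/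
open Matrix

/-- The `k`-th largest singular value of a real matrix, via the Courant–Fischer
max–min characterization. -/
noncomputable def singVal {a b : ℕ} (M : Matrix (Fin a) (Fin b) ℝ) (k : ℕ) : ℝ :=
  ⨆ S : {S : Submodule ℝ (EuclideanSpace ℝ (Fin b)) // Module.finrank ℝ S = k},
    ⨅ x : {x : EuclideanSpace ℝ (Fin b) // x ∈ S.1 ∧ ‖x‖ = 1},
      ‖Matrix.toEuclideanLin M x.1‖

/-- Frobenius norm of a real matrix. -/
noncomputable def frob {a b : ℕ} (A : Matrix (Fin a) (Fin b) ℝ) : ℝ :=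
  Real.sqrt (∑ i, ∑ j, (A i j) ^ 2)

/-- `prodSeg W i j = W_j W_{j-1} ⋯ W_i` (equal to `1` when `j < i`). -/
def prodSeg {d : ℕ} (W : ℕ → Matrix (Fin d) (Fin d) ℝ) (i : ℕ) :
    ℕ → Matrix (Fin d) (Fin d) ℝ
  | 0 => 1
  | j + 1 => if j + 1 < i then 1 else W (j + 1) * prodSeg W i j

open scoped RealInnerProductSpace Matrix.Norms.L2Operator

section SingularValues

variable {a b c : ℕ}

lemma toEuclideanLin_mul_apply (M : Matrix (Fin a) (Fin b) ℝ) (N : Matrix (Fin b) (Fin c) ℝ)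
    (x : EuclideanSpace ℝ (Fin c)) :
    toEuclideanLin (M * N) x = toEuclideanLin M (toEuclideanLin N x) := by
  simp [toLpLin_apply, Matrix.mulVec_mulVec]

lemma inner_toEuclideanLin_transpose (M : Matrix (Fin a) (Fin b) ℝ)
    (x : EuclideanSpace ℝ (Fin b)) (y : EuclideanSpace ℝ (Fin a)) :
    ⟪x, toEuclideanLin Mᵀ y⟫ = ⟪toEuclideanLin M x, y⟫ := by
  rw [← conjTranspose_eq_transpose_of_trivial, toEuclideanLin_conjTranspose_eq_adjoint,
    LinearMap.adjoint_inner_right]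

lemma inner_toEuclideanLin_transpose_mul_self (M : Matrix (Fin a) (Fin b) ℝ)
    (x : EuclideanSpace ℝ (Fin b)) :
    ⟪x, toEuclideanLin (Mᵀ * M) x⟫ = ‖toEuclideanLin M x‖ ^ 2 := by
  rw [toEuclideanLin_mul_apply, inner_toEuclideanLin_transpose, real_inner_self_eq_norm_sq]

lemma norm_toEuclideanLin_le (M : Matrix (Fin a) (Fin b) ℝ) (x : EuclideanSpace ℝ (Fin b)) :
    ‖toEuclideanLin M x‖ ≤ ‖M‖ * ‖x‖ :=
  l2_opNorm_mulVec M x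

lemma l2_opNorm_le_of_bound {M : Matrix (Fin a) (Fin b) ℝ} {r : ℝ} (hr : 0 ≤ r)
    (h : ∀ x, ‖toEuclideanLin M x‖ ≤ r * ‖x‖) : ‖M‖ ≤ r := by
  rw [l2_opNorm_def]
  exact ContinuousLinearMap.opNorm_le_bound _ hr h

lemma l2_opNorm_le_frob (M : Matrix (Fin a) (Fin b) ℝ) : ‖M‖ ≤ frob M := by
  refine l2_opNorm_le_of_bound (Real.sqrt_nonneg _) fun x => ?_
  rw [EuclideanSpace.norm_eq, EuclideanSpace.norm_eq, frob, ← Real.sqrt_mul (by positivity),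
    Finset.sum_mul]
  refine Real.sqrt_le_sqrt (Finset.sum_le_sum fun i _ => ?_)
  simpa [toLpLin_apply, mulVec, dotProduct] using
    Finset.sum_mul_sq_le_sq_mul_sq Finset.univ (M i) x

lemma singVal_nonneg (M : Matrix (Fin a) (Fin b) ℝ) (k : ℕ) : 0 ≤ singVal M k :=
  Real.iSup_nonneg fun _ => Real.iInf_nonneg fun _ => norm_nonneg _

/-- A subspace of dimension `k` on which `M` expands norms by a factor at least `r`. -/
def ExpandsOnDim (M : Matrix (Fin a) (Fin b) ℝ) (k : ℕ) (r : ℝ) : Prop :=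
  ∃ S : Submodule ℝ (EuclideanSpace ℝ (Fin b)), Module.finrank ℝ S = k ∧
    ∀ x ∈ S, r * ‖x‖ ≤ ‖toEuclideanLin M x‖

lemma ExpandsOnDim.le_singVal {M : Matrix (Fin a) (Fin b) ℝ} {k : ℕ} {r : ℝ} (hk : 0 < k)
    (h : ExpandsOnDim M k r) : r ≤ singVal M k := by
  obtain ⟨S, hS, hM⟩ := h
  have unit : ∀ T : Submodule ℝ (EuclideanSpace ℝ (Fin b)), Module.finrank ℝ T = k →
      ∃ x ∈ T, ‖x‖ = 1 := by
    intro T hT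
    have : Nontrivial T := Module.nontrivial_of_finrank_pos (R := ℝ) (by omega)
    obtain ⟨x, hx⟩ := exists_norm_eq T zero_le_one
    exact ⟨x, x.2, hx⟩
  have bdd : ∀ T : Submodule ℝ (EuclideanSpace ℝ (Fin b)), BddBelow (Set.range
      fun x : {x : EuclideanSpace ℝ (Fin b) // x ∈ T ∧ ‖x‖ = 1} => ‖toEuclideanLin M x.1‖) :=
    fun T => ⟨0, by rintro _ ⟨x, rfl⟩; exact norm_nonneg _⟩
  refine le_ciSup_of_le ⟨‖M‖, ?_⟩ ⟨S, hS⟩ ?_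
  · rintro _ ⟨T, rfl⟩
    obtain ⟨x, hxT, hx⟩ := unit T.1 T.2
    refine (ciInf_le (bdd T.1) ⟨x, hxT, hx⟩).trans ?_
    simpa [hx] using norm_toEuclideanLin_le M x
  · obtain ⟨x, hxS, hx⟩ := unit S hS
    have : Nonempty {x : EuclideanSpace ℝ (Fin b) // x ∈ S ∧ ‖x‖ = 1} := ⟨⟨x, hxS, hx⟩⟩
    refine le_ciInf fun y => ?_
    simpa [y.2.2] using hM y y.2.1

lemma expandsOnDim_of_lt_singVal {M : Matrix (Fin a) (Fin b) ℝ} {k : ℕ} {r : ℝ} (hr : 0 ≤ r)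
    (h : r < singVal M k) : ExpandsOnDim M k r := by
  have : Nonempty {S : Submodule ℝ (EuclideanSpace ℝ (Fin b)) // Module.finrank ℝ S = k} := by
    by_contra hne
    rw [not_nonempty_iff] at hne
    rw [singVal, Real.iSup_of_isEmpty] at h
    linarith
  obtain ⟨S, hS⟩ := exists_lt_of_lt_ciSup h
  refine ⟨S.1, S.2, fun x hx => ?_⟩
  rcases eq_or_ne x 0 with rfl | hx0
  · simp
  have hpos : 0 < ‖x‖ := norm_pos_iff.2 hx0
  have hle := hS.le.trans (ciInf_le ⟨0, by rintro _ ⟨x, rfl⟩; exact norm_nonneg _⟩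
    ⟨‖x‖⁻¹ • x, S.1.smul_mem _ hx, by simp [norm_smul, hpos.ne']⟩)
  rw [map_smul, norm_smul, norm_inv, norm_norm, inv_mul_eq_div, le_div_iff₀ hpos] at hle
  exact hle

lemma l2_opNorm_le_singVal_one (M : Matrix (Fin a) (Fin b) ℝ) : ‖M‖ ≤ singVal M 1 := by
  refine l2_opNorm_le_of_bound (singVal_nonneg M 1) fun x => ?_
  rcases eq_or_ne x 0 with rfl | hx
  · simp
  have hpos : 0 < ‖x‖ := norm_pos_iff.2 hx
  rw [← div_le_iff₀ hpos]
  refine ExpandsOnDim.le_singVal one_pos ⟨ℝ ∙ x, finrank_span_singleton hx, fun y hy => ?_⟩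
  obtain ⟨t, rfl⟩ := Submodule.mem_span_singleton.1 hy
  rw [map_smul, norm_smul, norm_smul]
  apply le_of_eq
  field_simp

lemma ExpandsOnDim.transpose {M : Matrix (Fin a) (Fin b) ℝ} {k : ℕ} {r : ℝ} (hr : 0 < r)
    (h : ExpandsOnDim M k r) : ExpandsOnDim Mᵀ k r := by
  obtain ⟨S, hS, hM⟩ := h
  refine ⟨S.map (toEuclideanLin M), ?_, ?_⟩
  · rw [← LinearMap.range_domRestrict, LinearMap.finrank_range_of_inj, hS]
    rw [← LinearMap.ker_eq_bot, LinearMap.ker_eq_bot']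
    intro x hx
    have h1 := hM x x.2
    rw [LinearMap.domRestrict_apply] at hx
    rw [hx, norm_zero] at h1
    exact norm_eq_zero.1 (le_antisymm (nonpos_of_mul_nonpos_right h1 hr) (norm_nonneg _))
  · rintro _ ⟨x, hx, rfl⟩
    have h1 := hM x hx
    set y := toEuclideanLin M x
    rcases eq_or_ne x 0 with rfl | hx0
    · simp [y]
    have hpos : 0 < ‖x‖ := norm_pos_iff.2 hx0
    have h2 : ‖y‖ ^ 2 ≤ ‖x‖ * ‖toEuclideanLin Mᵀ y‖ := by
      rw [← real_inner_self_eq_norm_sq, ← inner_toEuclideanLin_transpose]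
      exact real_inner_le_norm _ _
    have h3 : r * ‖x‖ * ‖y‖ ≤ ‖y‖ ^ 2 := by nlinarith [norm_nonneg y]
    refine le_of_mul_le_mul_left ?_ hpos
    linarith

lemma ExpandsOnDim.of_transpose_mul_self_eq {M : Matrix (Fin a) (Fin b) ℝ}
    {N : Matrix (Fin b) (Fin c) ℝ} {k : ℕ} {r : ℝ} (hr : 0 < r) (hMN : Mᵀ * M = N * Nᵀ)
    (h : ExpandsOnDim M k r) : ExpandsOnDim N k r := by
  have hnorm : ∀ x, ‖toEuclideanLin Nᵀ x‖ = ‖toEuclideanLin M x‖ := fun x => by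
    rw [← sq_eq_sq₀ (norm_nonneg _) (norm_nonneg _), ← inner_toEuclideanLin_transpose_mul_self,
      ← inner_toEuclideanLin_transpose_mul_self, hMN, transpose_transpose]
  obtain ⟨S, hS, hM⟩ := h
  simpa using ExpandsOnDim.transpose hr (M := Nᵀ) ⟨S, hS, fun x hx => (hnorm x).symm ▸ hM x hx⟩

/-- A matrix with `a` rows and `a`-th singular value `s` has a transpose bounded below by `s`. -/
lemma singVal_mul_norm_le_norm_transpose (M : Matrix (Fin a) (Fin b) ℝ)
    (u : EuclideanSpace ℝ (Fin a)) : singVal M a * ‖u‖ ≤ ‖toEuclideanLin Mᵀ u‖ := by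
  rcases eq_or_ne u 0 with rfl | hu
  · simp
  have hpos : 0 < ‖u‖ := norm_pos_iff.2 hu
  rw [← le_div_iff₀ hpos]
  refine le_of_forall_lt_imp_le_of_dense fun r hr => ?_
  rcases le_or_gt r 0 with hr0 | hr0
  · exact hr0.trans (by positivity)
  obtain ⟨S, hS, hM⟩ := (expandsOnDim_of_lt_singVal hr0.le hr).transpose hr0
  have : S = ⊤ := Submodule.eq_top_of_finrank_eq (by simpa using hS)
  rw [le_div_iff₀ hpos]
  exact hM u (this ▸ Submodule.mem_top)

end SingularValues

section Powers

lemma mul_pow_mul_eq_pow_succ {a b : ℕ} (X : Matrix (Fin a) (Fin b) ℝ)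
    (Y : Matrix (Fin b) (Fin a) ℝ) (m : ℕ) : X * (Y * X) ^ m * Y = (X * Y) ^ (m + 1) := by
  induction m with
  | zero => simp
  | succ m ih => rw [pow_succ (Y * X), pow_succ (X * Y), ← ih]; simp only [Matrix.mul_assoc]

lemma prodSeg_one_mul_transpose {d : ℕ} (W : ℕ → Matrix (Fin d) (Fin d) ℝ) (j : ℕ)
    (h : ∀ l ∈ Finset.Icc 1 j, (W (l + 1))ᵀ * W (l + 1) = W l * (W l)ᵀ) :
    prodSeg W 1 (j + 1) * (prodSeg W 1 (j + 1))ᵀ = (W (j + 1) * (W (j + 1))ᵀ) ^ (j + 1) := by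
  induction j with
  | zero => simp [prodSeg]
  | succ j ih =>
    have ih := ih fun l hl => h l (by simp only [Finset.mem_Icc] at hl ⊢; omega)
    have hs : prodSeg W 1 (j + 1 + 1) = W (j + 1 + 1) * prodSeg W 1 (j + 1) := by
      rw [prodSeg, if_neg (by omega)]
    rw [hs, transpose_mul, ← mul_pow_mul_eq_pow_succ, h (j + 1) (by simp), ← ih]
    simp only [Matrix.mul_assoc]

lemma norm_pow_sub_pow_le {R : Type*} [NormedRing R] {x y : R} {r : ℝ} (hx : ‖x‖ ≤ r)
    (hy : ‖y‖ ≤ r) (m : ℕ) : ‖x ^ (m + 1) - y ^ (m + 1)‖ ≤ (m + 1) * r ^ m * ‖x - y‖ := by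
  have hr : 0 ≤ r := (norm_nonneg x).trans hx
  induction m with
  | zero => simp
  | succ m ih =>
    have hpow : ‖x ^ (m + 1)‖ ≤ r ^ (m + 1) :=
      (norm_pow_le' x m.succ_pos).trans (pow_le_pow_left₀ (norm_nonneg x) hx _)
    have hsplit : x ^ (m + 1 + 1) - y ^ (m + 1 + 1)
        = x ^ (m + 1) * (x - y) + (x ^ (m + 1) - y ^ (m + 1)) * y := by
      rw [pow_succ x (m + 1), pow_succ y (m + 1)]; noncomm_ring
    rw [hsplit]
    calc _ ≤ ‖x ^ (m + 1)‖ * ‖x - y‖ + ‖x ^ (m + 1) - y ^ (m + 1)‖ * ‖y‖ :=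
          (norm_add_le _ _).trans (add_le_add (norm_mul_le _ _) (norm_mul_le _ _))
      _ ≤ r ^ (m + 1) * ‖x - y‖ + (m + 1) * r ^ m * ‖x - y‖ * r := by gcongr
      _ = _ := by push_cast; ring

end Powers

/-- The smallest eigenvalue `μ` of `V Vᵀ`, when `V Aᵐ⁺¹ Vᵀ ≥ n` and `A` is close to `Vᵀ V`. -/
lemma exists_eigenvalue_bound {K d : ℕ} (hK : 0 < K) (V : Matrix (Fin K) (Fin d) ℝ)
    (A : Matrix (Fin d) (Fin d) ℝ) {m : ℕ} {n ρ δ : ℝ} (hA : ‖A‖ ≤ ρ) (hV : ‖Vᵀ * V‖ ≤ ρ)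
    (hδ : ‖Vᵀ * V - A‖ ≤ δ)
    (hn : ∀ u, n * ‖u‖ ^ 2 ≤
      ⟪toEuclideanLin Vᵀ u, toEuclideanLin (A ^ (m + 1)) (toEuclideanLin Vᵀ u)⟫) :
    ∃ μ : ℝ, 0 ≤ μ ∧ n ≤ μ ^ (m + 2) + (m + 1) * ρ ^ (m + 1) * δ ∧
      ∀ u, μ * ‖u‖ ^ 2 ≤ ‖toEuclideanLin Vᵀ u‖ ^ 2 := by
  have hquad : ∀ u, ⟪u, toEuclideanLin (V * Vᵀ) u⟫ = ‖toEuclideanLin Vᵀ u‖ ^ 2 := fun u => by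
    simpa using inner_toEuclideanLin_transpose_mul_self Vᵀ u
  have hsymm : (toEuclideanLin (V * Vᵀ)).IsSymmetric := by
    rw [isSymmetric_toEuclideanLin_iff]
    simpa using isHermitian_mul_conjTranspose_self V
  have : Nonempty (Fin K) := ⟨⟨0, hK⟩⟩
  have hev := hsymm.hasEigenvalue_iInf_of_finiteDimensional
  set μ : ℝ := ⨅ x : {x : EuclideanSpace ℝ (Fin K) // x ≠ 0},
    RCLike.re ⟪toEuclideanLin (V * Vᵀ) x, (x : EuclideanSpace ℝ (Fin K))⟫ /
      ‖(x : EuclideanSpace ℝ (Fin K))‖ ^ 2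
  have hnn : ∀ x : {x : EuclideanSpace ℝ (Fin K) // x ≠ 0},
      0 ≤ RCLike.re ⟪toEuclideanLin (V * Vᵀ) x, (x : EuclideanSpace ℝ (Fin K))⟫ /
        ‖(x : EuclideanSpace ℝ (Fin K))‖ ^ 2 := fun x => by
    rw [real_inner_comm, hquad]
    simp only [RCLike.re_to_real]
    positivity
  have hμ0 : 0 ≤ μ := Real.iInf_nonneg hnn
  obtain ⟨u, hu⟩ := hev.exists_hasEigenvector
  have hμu : toEuclideanLin (V * Vᵀ) u = μ • u := hu.apply_eq_smul
  have hupos : 0 < ‖u‖ ^ 2 := by have := norm_pos_iff.2 hu.2; positivity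
  have hVu : ‖toEuclideanLin Vᵀ u‖ ^ 2 = μ * ‖u‖ ^ 2 := by
    rw [← hquad, hμu, inner_smul_right, real_inner_self_eq_norm_sq]
  have hle : ∀ x, μ * ‖x‖ ^ 2 ≤ ‖toEuclideanLin Vᵀ x‖ ^ 2 := fun x => by
    rcases eq_or_ne x 0 with rfl | hx
    · simp
    have hpos : 0 < ‖x‖ ^ 2 := by have := norm_pos_iff.2 hx; positivity
    rw [← le_div_iff₀ hpos, ← hquad, real_inner_comm]
    exact ciInf_le ⟨0, by rintro _ ⟨y, rfl⟩; exact hnn y⟩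
      (⟨x, hx⟩ : {x : EuclideanSpace ℝ (Fin K) // x ≠ 0})
  have hμρ : μ ≤ ρ := by
    refine le_of_mul_le_mul_right ?_ hupos
    rw [← hVu]
    have h1 := norm_toEuclideanLin_le Vᵀ u
    have h2 : ‖Vᵀ‖ * ‖Vᵀ‖ ≤ ρ := by
      have h3 := l2_opNorm_conjTranspose V
      have h4 := l2_opNorm_conjTranspose_mul_self V
      rw [conjTranspose_eq_transpose_of_trivial] at h3 h4
      rw [h3, ← h4]
      exact hV
    calc _ ≤ (‖Vᵀ‖ * ‖u‖) ^ 2 := by gcongr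
      _ = ‖Vᵀ‖ * ‖Vᵀ‖ * ‖u‖ ^ 2 := by ring
      _ ≤ _ := by gcongr
  refine ⟨μ, hμ0, ?_, hle⟩
  have hpow : ∀ j : ℕ, toEuclideanLin ((V * Vᵀ) ^ j) u = μ ^ j • u := fun j => by
    induction j with
    | zero => simp
    | succ j ih => rw [pow_succ, toEuclideanLin_mul_apply, hμu, map_smul, ih, smul_smul, pow_succ']
  set w := toEuclideanLin Vᵀ u with hw
  have hB : ⟪w, toEuclideanLin ((Vᵀ * V) ^ (m + 1)) w⟫ = μ ^ (m + 2) * ‖u‖ ^ 2 := by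
    rw [real_inner_comm, hw, inner_toEuclideanLin_transpose, ← toEuclideanLin_mul_apply,
      ← toEuclideanLin_mul_apply, mul_pow_mul_eq_pow_succ, hpow,
      real_inner_smul_left, real_inner_self_eq_norm_sq]
  have hdiff : ⟪w, toEuclideanLin (A ^ (m + 1)) w⟫ - ⟪w, toEuclideanLin ((Vᵀ * V) ^ (m + 1)) w⟫
      ≤ (m + 1) * ρ ^ m * δ * ‖w‖ ^ 2 := by
    rw [← inner_sub_right, ← LinearMap.sub_apply, ← map_sub]
    have h1 := norm_pow_sub_pow_le hA hV m
    rw [norm_sub_rev A] at h1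
    have hρ : 0 ≤ ρ := (norm_nonneg _).trans hA
    calc _ ≤ ‖w‖ * ‖toEuclideanLin (A ^ (m + 1) - (Vᵀ * V) ^ (m + 1)) w‖ := real_inner_le_norm _ _
      _ ≤ ‖w‖ * (‖A ^ (m + 1) - (Vᵀ * V) ^ (m + 1)‖ * ‖w‖) := by
          gcongr; exact norm_toEuclideanLin_le _ _
      _ ≤ ‖w‖ * ((m + 1) * ρ ^ m * δ * ‖w‖) := by
          gcongr
          exact h1.trans (by gcongr)
      _ = _ := by ring
  have hδ0 : 0 ≤ δ := (norm_nonneg _).trans hδ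
  have hρ : 0 ≤ ρ := (norm_nonneg _).trans hA
  refine le_of_mul_le_mul_right ?_ hupos
  have h1 := hn u
  have h2 : (m + 1) * ρ ^ m * δ * ‖w‖ ^ 2 ≤ (m + 1) * ρ ^ (m + 1) * δ * ‖u‖ ^ 2 := by
    rw [hVu]
    calc _ = (m + 1) * ρ ^ m * δ * ‖u‖ ^ 2 * μ := by ring
      _ ≤ (m + 1) * ρ ^ m * δ * ‖u‖ ^ 2 * ρ := by gcongr
      _ = _ := by ring
  linarith

/-- A scalar lower bound for `μ` from `n ≤ μ ^ L + (L - 1) ρ ^ (L - 1) δ`, where `L = m + 2`. -/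
lemma le_of_le_pow_add {m : ℕ} {n ν ρ δ μ : ℝ} (hν : 0 < ν) (hνn : ν ^ (m + 2) = n)
    (hνρ : ν ≤ ρ) (hρn : ρ ^ (m + 2) = 2 * n) (hδ : δ ≤ ν / (30 * (m + 2 : ℝ) ^ 2)) (hμ : 0 ≤ μ)
    (h : n ≤ μ ^ (m + 2) + (m + 1) * ρ ^ (m + 1) * δ) :
    ν * (1 - 1 / (15 * (m + 2 : ℝ))) ≤ μ := by
  by_contra! hlt
  have hn : 0 < n := hνn ▸ by positivity
  have hρ : 0 < ρ := hν.trans_le hνρ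
  have herr : (m + 1) * ρ ^ (m + 1) * δ ≤ n * (1 / (15 * (m + 2 : ℝ))) * ((m + 1) / (m + 2)) := by
    calc _ ≤ (m + 1) * ρ ^ (m + 1) * (ρ / (30 * (m + 2 : ℝ) ^ 2)) := by
          gcongr; exact hδ.trans (by gcongr)
      _ = (m + 1) * ρ ^ (m + 2) / (30 * (m + 2 : ℝ) ^ 2) := by ring
      _ = _ := by rw [hρn]; field_simp; ring
  have herr' : n * (1 / (15 * (m + 2 : ℝ))) * ((m + 1) / (m + 2)) < n * (1 / (15 * (m + 2 : ℝ))) :=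
    mul_lt_of_lt_one_right (by positivity) (by rw [div_lt_one (by positivity)]; linarith)
  have ht : μ / ν < 1 - 1 / (15 * (m + 2 : ℝ)) := by rwa [div_lt_iff₀' hν]
  have hinv : 0 < 1 / (15 * (m + 2 : ℝ)) := by positivity
  have hpow : (μ / ν) ^ (m + 2) ≤ μ / ν :=
    pow_le_of_le_one (by positivity) (by linarith) (by omega)
  rw [div_pow, hνn, div_le_iff₀ hn] at hpow
  nlinarith

/-- Bernoulli's inequality in the form `(n / 2) ^ (1 / L) ≤ n ^ (1 / L) (1 - 1 / (2 L))`. -/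
lemma rpow_half_le {L : ℕ} (hL : 0 < L) {n : ℝ} (hn : 0 < n) :
    (n / 2) ^ ((1 : ℝ) / L) ≤ n ^ ((1 : ℝ) / L) * (1 - 1 / (2 * L)) := by
  have hL1 : (1 : ℝ) ≤ L := by exact_mod_cast hL
  have hle : 1 / (2 * (L : ℝ)) ≤ 1 := by rw [div_le_one (by positivity)]; linarith
  have hb : (0 : ℝ) ≤ 1 - 1 / (2 * (L : ℝ)) := by linarith
  have hbern : (1 : ℝ) / 2 ≤ (1 - 1 / (2 * (L : ℝ))) ^ L := by
    have := one_add_mul_le_pow (a := -(1 / (2 * (L : ℝ)))) (by linarith) L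
    have he : 1 + (L : ℝ) * -(1 / (2 * (L : ℝ))) = 1 / 2 := by field_simp; norm_num
    rw [he] at this
    simpa [sub_eq_add_neg] using this
  rw [one_div (L : ℝ), Real.rpow_inv_le_iff_of_pos (by positivity) (by positivity) (by positivity),
    Real.rpow_natCast, mul_pow, Real.rpow_inv_natCast_pow hn.le hL.ne']
  nlinarith

/-- Lower bound on the `K`-th singular value of each layer of an approximately balanced
deep linear network whose end-to-end product has all `K` singular values equal to `√n`. -/
theorem layer_singular_value_lower_bound {d K L : ℕ} (hK : 0 < K) (hKd : K < d)
    (hL : 2 ≤ L) (n δ : ℝ) (hn : 0 < n)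
    (W : ℕ → Matrix (Fin d) (Fin d) ℝ) (WL : Matrix (Fin K) (Fin d) ℝ)
    (hσ1prod : singVal (WL * prodSeg W 1 (L - 1)) 1 = Real.sqrt n)
    (hσKprod : singVal (WL * prodSeg W 1 (L - 1)) K = Real.sqrt n)
    (hrank : (WL * prodSeg W 1 (L - 1)).rank = K)
    (hbal : ∀ l ∈ Finset.Icc 1 (L - 2), (W (l + 1))ᵀ * W (l + 1) = W l * (W l)ᵀ)
    (hδ : frob (WLᵀ * WL - W (L - 1) * (W (L - 1))ᵀ) ≤ δ)
    (hδsmall : δ ≤ n ^ ((1 : ℝ) / L) / (30 * (L : ℝ) ^ 2))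
    (htop : ∀ l ∈ Finset.Icc 1 (L - 1), singVal (W l) 1 ≤ (2 * n) ^ ((1 : ℝ) / (2 * L)))
    (htopL : singVal WL 1 ≤ (2 * n) ^ ((1 : ℝ) / (2 * L))) :
    (∀ l ∈ Finset.Icc 1 (L - 1), (n / 2) ^ ((1 : ℝ) / (2 * L)) ≤ singVal (W l) K) ∧
    (n / 2) ^ ((1 : ℝ) / (2 * L)) ≤ singVal WL K := by
  obtain ⟨m, rfl⟩ : ∃ m, L = m + 2 := ⟨L - 2, by omega⟩
  simp only [show m + 2 - 1 = m + 1 by omega, show m + 2 - 2 = m by omega] at *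
  have hcast : ((m + 2 : ℕ) : ℝ) = m + 2 := by push_cast; ring
  set R : ℝ := (2 * n) ^ ((1 : ℝ) / (2 * (m + 2 : ℕ))) with hR
  set ν : ℝ := n ^ ((1 : ℝ) / (m + 2 : ℕ)) with hν
  set κ : ℝ := (n / 2) ^ ((1 : ℝ) / (2 * (m + 2 : ℕ))) with hκ
  have hhalf : ∀ x : ℝ, 0 ≤ x → (x ^ ((1 : ℝ) / (2 * (m + 2 : ℕ)))) ^ 2
      = x ^ ((1 : ℝ) / (m + 2 : ℕ)) := fun x hx => by
    rw [← Real.rpow_natCast, ← Real.rpow_mul hx]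
    congr 1
    push_cast
    field_simp
  have hν0 : 0 < ν := by positivity
  have hκ0 : 0 < κ := by positivity
  have hR0 : 0 < R := by positivity
  have hνn : ν ^ (m + 2) = n := by
    rw [hν, one_div, Real.rpow_inv_natCast_pow hn.le (by omega)]
  have hRn : (R ^ 2) ^ (m + 2) = 2 * n := by
    rw [hR, hhalf _ (by positivity), one_div, Real.rpow_inv_natCast_pow (by positivity) (by omega)]
  have hνR : ν ≤ R ^ 2 := by
    rw [hR, hhalf _ (by positivity)]
    exact Real.rpow_le_rpow hn.le (by linarith) (by positivity)
  have hκν : κ ^ 2 ≤ ν * (1 - 1 / (2 * (m + 2 : ℝ))) := by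
    rw [hκ, hhalf _ (by positivity), ← hcast]
    exact rpow_half_le (by omega) hn
  rw [hcast] at hδsmall
  set X := W (m + 1)
  have hXR : ‖X‖ ≤ R := (l2_opNorm_le_singVal_one X).trans (htop (m + 1) (by simp))
  have hVR : ‖WL‖ ≤ R := (l2_opNorm_le_singVal_one WL).trans htopL
  have hXt : ‖Xᵀ‖ = ‖X‖ := by
    rw [← conjTranspose_eq_transpose_of_trivial, l2_opNorm_conjTranspose]
  have hVt : ‖WLᵀ‖ = ‖WL‖ := by
    rw [← conjTranspose_eq_transpose_of_trivial, l2_opNorm_conjTranspose]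
  have hA : ‖X * Xᵀ‖ ≤ R ^ 2 := by
    refine (l2_opNorm_mul _ _).trans ?_
    rw [hXt, sq]
    gcongr
  have hB : ‖WLᵀ * WL‖ ≤ R ^ 2 := by
    refine (l2_opNorm_mul _ _).trans ?_
    rw [hVt, sq]
    gcongr
  have hD : ‖WLᵀ * WL - X * Xᵀ‖ ≤ δ := (l2_opNorm_le_frob _).trans hδ
  obtain ⟨μ, hμ0, hμn, hμ⟩ := exists_eigenvalue_bound hK WL (X * Xᵀ) (m := m) hA hB hD
    (n := n) fun u => by
      have h1 := singVal_mul_norm_le_norm_transpose (WL * prodSeg W 1 (m + 1)) u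
      rw [hσKprod] at h1
      have h2 := pow_le_pow_left₀ (by positivity) h1 2
      rw [mul_pow, Real.sq_sqrt hn.le] at h2
      refine h2.trans (le_of_eq ?_)
      rw [← prodSeg_one_mul_transpose W m hbal, toEuclideanLin_mul_apply, transpose_mul,
        toEuclideanLin_mul_apply, ← real_inner_self_eq_norm_sq, inner_toEuclideanLin_transpose,
        real_inner_comm]
  have hμν := le_of_le_pow_add hν0 hνn hνR hRn hδsmall hμ0 hμn
  have hgap : κ ^ 2 + δ ≤ μ := by
    have h1 : ν / (30 * (m + 2 : ℝ) ^ 2) ≤ ν * (1 / (15 * (m + 2 : ℝ))) := by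
      rw [div_eq_mul_one_div]
      gcongr ν * (1 / ?_)
      nlinarith [(Nat.cast_nonneg m : (0 : ℝ) ≤ m)]
    have h2 : ν * (1 / (15 * (m + 2 : ℝ))) + ν * (1 / (15 * (m + 2 : ℝ)))
        ≤ ν * (1 / (2 * (m + 2 : ℝ))) := by
      rw [← mul_add]
      gcongr
      rw [← add_div, div_le_div_iff₀ (by positivity) (by positivity)]
      nlinarith [(Nat.cast_nonneg m : (0 : ℝ) ≤ m)]
    linarith
  have hδ0 : 0 ≤ δ := (norm_nonneg _).trans hD
  have hsqrt : √μ ^ 2 = μ := Real.sq_sqrt hμ0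
  have hμpos : 0 < μ := by have := pow_pos hκ0 2; linarith
  have hκμ : κ ≤ √μ := Real.le_sqrt_of_sq_le (by linarith)
  obtain ⟨S, hS, hSV⟩ : ExpandsOnDim WL K √μ := by
    simpa using ExpandsOnDim.transpose (M := WLᵀ) (k := K) (Real.sqrt_pos.2 hμpos)
      ⟨⊤, by simp, fun x _ => by
        rw [← sq_le_sq₀ (by positivity) (by positivity), mul_pow, hsqrt]
        exact hμ x⟩
  have hlast : ExpandsOnDim Xᵀ K κ := by
    refine ⟨S, hS, fun x hx => ?_⟩
    rw [← sq_le_sq₀ (by positivity) (by positivity), mul_pow]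
    have h1 := pow_le_pow_left₀ (by positivity) (hSV x hx) 2
    rw [mul_pow, hsqrt] at h1
    have h2 : ‖toEuclideanLin WL x‖ ^ 2 - ‖toEuclideanLin Xᵀ x‖ ^ 2 ≤ δ * ‖x‖ ^ 2 := by
      rw [← inner_toEuclideanLin_transpose_mul_self, ← inner_toEuclideanLin_transpose_mul_self,
        transpose_transpose, ← inner_sub_right, ← LinearMap.sub_apply, ← map_sub]
      calc _ ≤ ‖x‖ * ‖toEuclideanLin (WLᵀ * WL - X * Xᵀ) x‖ := real_inner_le_norm _ _
        _ ≤ ‖x‖ * (δ * ‖x‖) := by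
            gcongr
            exact (norm_toEuclideanLin_le _ x).trans (by gcongr)
        _ = _ := by ring
    nlinarith [sq_nonneg ‖x‖]
  have hlayers : ∀ l, l ≤ m → ExpandsOnDim (W (m + 1 - l)) K κ := fun l => by
    induction l with
    | zero => exact fun _ => by simpa using hlast.transpose hκ0
    | succ l ih =>
      intro hl
      refine (ih (by omega)).of_transpose_mul_self_eq hκ0 ?_
      have := hbal (m + 1 - (l + 1)) (by simp only [Finset.mem_Icc]; omega)
      rwa [show m + 1 - (l + 1) + 1 = m + 1 - l by omega] at this
  refine ⟨fun l hl => ?_, hκμ.trans (ExpandsOnDim.le_singVal hK ⟨S, hS, hSV⟩)⟩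
  rw [Finset.mem_Icc] at hl
  have := (hlayers (m + 1 - l) (by omega)).le_singVal hK
  rwa [show m + 1 - (m + 1 - l) = l by omega] at this
end

section
/- If square matrices W₁,…,W_{L−1} ∈ ℝ^{d×d} satisfy the balancedness conditions W_{l+1}ᵀW_{l+1} = W_l W_lᵀ for all l ∈ [L−2], then all W_l share the same singular values, and one can choose SVDs W_l = U_l Σ V_lᵀ with a common diagonal Σ such that V_{l+1} = U_l for all l ∈ [L−2]; consequently W_{l}⋯W₁ = U_l Σ^l V₁ᵀ for all l ∈ [L−1]. -/
open Matrix

/-- A real matrix whose Gram matrix is `diagonal (s ^ 2)` factors as an orthogonal matrix times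
`diagonal s`. -/
theorem exists_orthogonal_mul_diagonal {n : Type*} [Fintype n] [DecidableEq n]
    (A : Matrix n n ℝ) (s : n → ℝ) (hA : Aᵀ * A = diagonal fun i => s i ^ 2) :
    ∃ U : Matrix n n ℝ, Uᵀ * U = 1 ∧ A = U * diagonal s := by
  have hcol : ∀ i j, ∑ k, A k i * A k j = if i = j then s i ^ 2 else 0 := fun i j => by
    simpa [mul_apply, diagonal_apply] using congrFun (congrFun hA i) j
  let v : n → EuclideanSpace ℝ n := fun j => WithLp.toLp 2 fun k => (s j)⁻¹ * A k j
  have hv : Orthonormal ℝ ({j | s j ≠ 0}.domRestrict v) := by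
    rw [orthonormal_iff_ite]
    rintro ⟨i, hi⟩ ⟨j, hj⟩
    have h : inner ℝ (v i) (v j) = (s i)⁻¹ * (s j)⁻¹ * ∑ k, A k i * A k j := by
      simp only [v, EuclideanSpace.inner_toLp_toLp, dotProduct, Finset.mul_sum, Pi.star_apply,
        star_trivial]
      exact Finset.sum_congr rfl fun k _ => by ring
    simp only [Set.domRestrict_apply, Subtype.mk.injEq]
    rw [h, hcol]
    split_ifs with hij
    · subst hij
      have hi' : s i ≠ 0 := hi
      field_simp
    · simp
  obtain ⟨b, hb⟩ := hv.exists_orthonormalBasis_extension_of_card_eq (by simp)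
  refine ⟨of fun i j => b j i, ?_, ?_⟩
  · ext i j
    have h := orthonormal_iff_ite.mp b.orthonormal i j
    rw [EuclideanSpace.inner_eq_star_dotProduct] at h
    simpa [mul_apply, one_apply, dotProduct, mul_comm] using h
  · ext i j
    rw [mul_diagonal, of_apply]
    by_cases hj : s j = 0
    · have h := hcol j j
      simp only [hj, if_true, ne_eq, OfNat.ofNat_ne_zero, not_false_eq_true, zero_pow] at h
      rw [Finset.sum_eq_zero_iff_of_nonneg fun k _ => mul_self_nonneg _] at h
      simpa [hj] using h i (Finset.mem_univ i)
    · rw [hb j hj]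
      simp only [v]
      field_simp

/-- If `V` is orthogonal and diagonalizes `Wᵀ * W` with eigenvalues `s ^ 2`, then `V` is the right
factor of a singular value decomposition of `W`. -/
theorem exists_left_singular_factor {n : Type*} [Fintype n] [DecidableEq n]
    (W V : Matrix n n ℝ) (s : n → ℝ) (hV : Vᵀ * V = 1)
    (hW : Wᵀ * W = V * diagonal s ^ 2 * Vᵀ) :
    ∃ U : Matrix n n ℝ, Uᵀ * U = 1 ∧ W = U * diagonal s * Vᵀ := by
  obtain ⟨U, hU, h⟩ := exists_orthogonal_mul_diagonal (W * V) s (by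
    calc (W * V)ᵀ * (W * V) = Vᵀ * (Wᵀ * W) * V := by
          simp only [transpose_mul, Matrix.mul_assoc]
      _ = (Vᵀ * V) * diagonal s ^ 2 * (Vᵀ * V) := by rw [hW]; simp only [Matrix.mul_assoc]
      _ = diagonal fun i => s i ^ 2 := by simp [hV, diagonal_pow, Pi.pow_def])
  exact ⟨U, hU, by rw [← h, Matrix.mul_assoc, mul_eq_one_comm.mp hV, Matrix.mul_one]⟩

/-- `Wᵀ * W` is orthogonally diagonalizable with nonincreasing eigenvalues `s ^ 2`, `s ≥ 0`. -/
theorem exists_antitone_diagonalization_gram {d : ℕ} (W : Matrix (Fin d) (Fin d) ℝ) :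
    ∃ (V : Matrix (Fin d) (Fin d) ℝ) (s : Fin d → ℝ), Vᵀ * V = 1 ∧ (∀ i, 0 ≤ s i) ∧
      Antitone s ∧ Wᵀ * W = V * diagonal s ^ 2 * Vᵀ := by
  have hp : (Wᵀ * W).PosSemidef := by
    simpa [conjTranspose_eq_transpose_of_trivial] using posSemidef_conjTranspose_mul_self W
  set e := hp.1.eigenvalues
  set Q := (hp.1.eigenvectorUnitary).val
  have hQQ : Qᵀ * Q = 1 := by
    have h := (mem_unitaryGroup_iff').mp hp.1.eigenvectorUnitary.2
    rwa [star_eq_conjTranspose, conjTranspose_eq_transpose_of_trivial] at h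
  have hspec : Wᵀ * W = Q * diagonal e * Qᵀ := by
    have h := hp.1.spectral_theorem
    rw [Unitary.conjStarAlgAut_apply, star_eq_conjTranspose,
      conjTranspose_eq_transpose_of_trivial] at h
    exact h
  let p : Equiv.Perm (Fin d) := Tuple.sort fun i => -e i
  have hmono : Monotone fun i => -e (p i) := Tuple.monotone_sort fun i => -e i
  refine ⟨Q.submatrix id p, fun i => √(e (p i)), ?_, fun i => Real.sqrt_nonneg _,
    fun i j hij => Real.sqrt_le_sqrt (neg_le_neg_iff.mp (hmono hij)), ?_⟩
  · rw [transpose_submatrix, ← submatrix_mul _ _ _ _ _ Function.bijective_id, hQQ,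
      submatrix_one_equiv]
  · have hd : diagonal (fun i => √(e (p i))) ^ 2 = (diagonal e).submatrix p p := by
      rw [diagonal_pow, submatrix_diagonal_equiv]
      congr 1
      ext i
      exact Real.sq_sqrt (hp.eigenvalues_nonneg _)
    rw [hd, transpose_submatrix, submatrix_mul_equiv, submatrix_mul_equiv, submatrix_id_id, hspec]

/-- Balanced square weight matrices share a common diagonal singular-value matrix `Σ`
and admit aligned SVDs `W_l = U_l Σ V_lᵀ` with `V_{l+1} = U_l`; consequently
`W_l ⋯ W_1 = U_l Σ^l V_1ᵀ`. -/
theorem balanced_aligned_svd {d L : ℕ} (hL : 2 ≤ L)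
    (W : ℕ → Matrix (Fin d) (Fin d) ℝ)
    (hbal : ∀ l ∈ Finset.Icc 1 (L - 2), (W (l + 1))ᵀ * W (l + 1) = W l * (W l)ᵀ) :
    ∃ (U V : ℕ → Matrix (Fin d) (Fin d) ℝ) (Sig : Matrix (Fin d) (Fin d) ℝ),
      Sig.IsDiag ∧ (∀ i : Fin d, 0 ≤ Sig i i) ∧
      (∀ i j : Fin d, i ≤ j → Sig j j ≤ Sig i i) ∧
      (∀ l ∈ Finset.Icc 1 (L - 1), (U l)ᵀ * U l = 1 ∧ U l * (U l)ᵀ = 1) ∧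
      (∀ l ∈ Finset.Icc 1 (L - 1), (V l)ᵀ * V l = 1 ∧ V l * (V l)ᵀ = 1) ∧
      (∀ l ∈ Finset.Icc 1 (L - 1), W l = U l * Sig * (V l)ᵀ) ∧
      (∀ l ∈ Finset.Icc 1 (L - 2), V (l + 1) = U l) ∧
      (∀ l ∈ Finset.Icc 1 (L - 1), prodSeg W 1 l = U l * Sig ^ l * (V 1)ᵀ) := by
  obtain ⟨V₁, s, hV₁, hs, hanti, hW₁⟩ := exists_antitone_diagonalization_gram (W 1)
  have step : ∀ A V : Matrix (Fin d) (Fin d) ℝ, ∃ U : Matrix (Fin d) (Fin d) ℝ,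
      Vᵀ * V = 1 → Aᵀ * A = V * diagonal s ^ 2 * Vᵀ →
        Uᵀ * U = 1 ∧ A = U * diagonal s * Vᵀ := fun A V => by
    by_cases h : Vᵀ * V = 1 ∧ Aᵀ * A = V * diagonal s ^ 2 * Vᵀ
    · obtain ⟨U, hU⟩ := exists_left_singular_factor A V s h.1 h.2
      exact ⟨U, fun _ _ => hU⟩
    · exact ⟨1, fun h₁ h₂ => absurd ⟨h₁, h₂⟩ h⟩
  choose f hf using step
  let U : ℕ → Matrix (Fin d) (Fin d) ℝ := fun n => Nat.rec V₁ (fun k V => f (W (k + 1)) V) n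
  have key : ∀ n, n + 1 ≤ L - 1 → (U n)ᵀ * U n = 1 ∧ (U (n + 1))ᵀ * U (n + 1) = 1 ∧
      W (n + 1) = U (n + 1) * diagonal s * (U n)ᵀ := by
    intro n
    induction n with
    | zero => exact fun _ => ⟨hV₁, hf _ _ hV₁ hW₁⟩
    | succ k ih =>
      intro hk
      obtain ⟨h₀, h₁, h₂⟩ := ih (by omega)
      refine ⟨h₁, hf _ _ h₁ ?_⟩
      calc (W (k + 1 + 1))ᵀ * W (k + 1 + 1) = W (k + 1) * (W (k + 1))ᵀ :=
            hbal _ (Finset.mem_Icc.mpr ⟨by omega, by omega⟩)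
        _ = U (k + 1) * diagonal s * ((U k)ᵀ * U k) * diagonal s * (U (k + 1))ᵀ := by
            rw [h₂]
            simp only [transpose_mul, transpose_transpose, diagonal_transpose, Matrix.mul_assoc]
        _ = U (k + 1) * diagonal s ^ 2 * (U (k + 1))ᵀ := by
            rw [h₀, Matrix.mul_one, pow_two]
            simp only [Matrix.mul_assoc]
  have hprod : ∀ n, n + 1 ≤ L - 1 →
      prodSeg W 1 (n + 1) = U (n + 1) * diagonal s ^ (n + 1) * (U 0)ᵀ := by
    intro n
    induction n with
    | zero =>
      intro h
      simpa [prodSeg] using (key 0 h).2.2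
    | succ k ih =>
      intro hk
      obtain ⟨h₀, -, h₂⟩ := key (k + 1) hk
      calc prodSeg W 1 (k + 1 + 1) = W (k + 1 + 1) * prodSeg W 1 (k + 1) := by
            rw [prodSeg, if_neg (by omega)]
        _ = U (k + 1 + 1) * diagonal s * ((U (k + 1))ᵀ * U (k + 1)) * diagonal s ^ (k + 1) *
              (U 0)ᵀ := by
            rw [ih (by omega), h₂]
            simp only [Matrix.mul_assoc]
        _ = U (k + 1 + 1) * diagonal s ^ (k + 1 + 1) * (U 0)ᵀ := by
            rw [h₀, Matrix.mul_one, pow_succ' _ (k + 1)]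
            simp only [Matrix.mul_assoc]
  refine ⟨U, fun l => U (l - 1), diagonal s, isDiag_diagonal s, fun i => by simpa using hs i,
    fun i j hij => by simpa using hanti hij, ?_, ?_, ?_, fun l _ => rfl, ?_⟩
  all_goals
    intro l hl
    obtain ⟨h₁, h₂⟩ := Finset.mem_Icc.mp hl
    obtain ⟨n, rfl⟩ := Nat.exists_eq_add_of_le' h₁
  · exact ⟨(key n h₂).2.1, mul_eq_one_comm.mp (key n h₂).2.1⟩
  · exact ⟨(key n h₂).1, mul_eq_one_comm.mp (key n h₂).1⟩
  · exact (key n h₂).2.2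
  · exact hprod n h₂
end
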